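/- For every k with 1 ≤ k ≤ n and every hyperplane A in Q (not necessarily belonging to 𝒜) with max F(A) = k, one has w_k(A) ≤ ν(F(A)) = ∏_{j ∈ F(A)} 1/((1−δ_j)|S_j|). -/

import Mathlib

open Finset
open scoped Classical

/-- A hyperplane in `S_1 × ⋯ × S_n`.  Coordinates are 0-indexed in Lean:
coordinate `j : ℕ`, `j < n`, corresponds to the paper's coordinate `j + 1`,
so the paper's set `S_j` is `S (j - 1)` here.  A hyperplane is recorded by its
finite set `F` of fixed coordinates together with the fixed value at each
fixed coordinate (on the non-fixed coordinates it is all of `S j`). -/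
structure Hyp (S : ℕ → Type) (n : ℕ) where
  F : Finset ℕ
  hF : ∀ j ∈ F, j < n
  val : ∀ j ∈ F, S j

/-- The stage of a hyperplane: in the paper's 1-based labelling,
`A.stage = max F(A)`; in the 0-based labelling it is `(sup of A.F) + 1`. -/
def Hyp.stage {S : ℕ → Type} {n : ℕ} (A : Hyp S n) : ℕ := A.F.sup id + 1

/-- `Qp S k` is the paper's `Q_k = S_1 × ⋯ × S_k` (in 0-based indexing,
`S 0 × ⋯ × S (k-1)`).  `Qp S 0` is a one-element type. -/
abbrev Qp (S : ℕ → Type) (k : ℕ) := ∀ j : Fin k, S j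

/-- `x ∈ Q_k` lies on (the projection to `Q_k` of) the hyperplane `A`;
this is the correct notion of membership whenever `F(A) ⊆ {1, …, k}`. -/
def memH {S : ℕ → Type} {n : ℕ} (A : Hyp S n) {k : ℕ} (x : Qp S k) : Prop :=
  ∀ (j : Fin k) (h : (j : ℕ) ∈ A.F), x j = A.val j h

/-- Membership in `B_k = ⋃_{A ∈ 𝒜_k} A`, viewed as a subset of `Q_k`, where
`𝒜_k = {A ∈ 𝒜 : max F(A) = k}` (1-based `k`). -/
def memB {S : ℕ → Type} {n : ℕ} {ι : Type} (𝓐 : ι → Hyp S n) (k : ℕ) (x : Qp S k) : Prop :=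
  ∃ i, (𝓐 i).stage = k ∧ memH (𝓐 i) x

/-- `alpha 𝓐 k x` is the paper's `α_{k+1}(x)` for `x ∈ Q_k`: the proportion of
the fiber `F_x` covered by `B_{k+1}`. -/
noncomputable def alpha {S : ℕ → Type} [∀ j, Fintype (S j)] {n : ℕ} {ι : Type}
    (𝓐 : ι → Hyp S n) (k : ℕ) (x : Qp S k) : ℝ :=
  ((univ.filter fun y : S k => memB 𝓐 (k + 1) (Fin.snoc x y)).card : ℝ) /
    (Fintype.card (S k))

/-- The weights `w_k : Q_k → ℝ`, defined inductively:  `w_0 ≡ 1`, and `w_(k+1)`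
is obtained from `w_k` by the distortion rule with parameter `δ_{k+1} = δ k`.
(The paper's `δ_j` is `δ (j - 1)` here.) -/
noncomputable def w {S : ℕ → Type} [∀ j, Fintype (S j)] {n : ℕ} {ι : Type}
    (𝓐 : ι → Hyp S n) (δ : ℕ → ℝ) : (k : ℕ) → Qp S k → ℝ
  | 0, _ => 1
  | (k + 1), x =>
      let x' : Qp S k := fun j => x j.castSucc
      let a : ℝ := alpha 𝓐 k x'
      if memB 𝓐 (k + 1) x then
        if a ≤ δ k then 0
        else ((a - δ k) / (a * (1 - δ k))) * (w 𝓐 δ k x' / (Fintype.card (S k)))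
      else
        if a ≤ δ k then (1 / (1 - a)) * (w 𝓐 δ k x' / (Fintype.card (S k)))
        else (1 / (1 - δ k)) * (w 𝓐 δ k x' / (Fintype.card (S k)))

/-- `w_k(B_k)` (1-based `k`). -/
noncomputable def wB {S : ℕ → Type} [∀ j, Fintype (S j)] {n : ℕ} {ι : Type}
    (𝓐 : ι → Hyp S n) (δ : ℕ → ℝ) (k : ℕ) : ℝ :=
  ∑ x ∈ univ.filter (memB 𝓐 k), w 𝓐 δ k x

/-- `w_k(A)`: the weight of the projection to `Q_k` of a hyperplane `A`
(meaningful when `F(A) ⊆ {1, …, k}`). -/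
noncomputable def wH {S : ℕ → Type} [∀ j, Fintype (S j)] {n : ℕ} {ι : Type}
    (𝓐 : ι → Hyp S n) (δ : ℕ → ℝ) (k : ℕ) (A : Hyp S n) : ℝ :=
  ∑ x ∈ univ.filter (fun x : Qp S k => memH A x), w 𝓐 δ k x

/-- `ν(J) = ∏_{j ∈ J} 1 / ((1 - δ_j)|S_j|)` (0-based `J`). -/
noncomputable def nu (S : ℕ → Type) [∀ j, Fintype (S j)] (δ : ℕ → ℝ) (J : Finset ℕ) : ℝ :=
  ∏ j ∈ J, 1 / ((1 - δ j) * (Fintype.card (S j)))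

/-- `‖J‖ = ∏_{j ∈ J} |S_j|` (0-based `J`). -/
noncomputable def normJ (S : ℕ → Type) [∀ j, Fintype (S j)] (J : Finset ℕ) : ℝ :=
  ∏ j ∈ J, (Fintype.card (S j) : ℝ)

/-- `Ew 𝓐 δ k` is the paper's `E_k = E_{(k+1)-1} = ∑_{x ∈ Q_k} α_{k+1}(x)² w_k(x)`. -/
noncomputable def Ew {S : ℕ → Type} [∀ j, Fintype (S j)] {n : ℕ} {ι : Type}
    (𝓐 : ι → Hyp S n) (δ : ℕ → ℝ) (k : ℕ) : ℝ :=
  ∑ x : Qp S k, (alpha 𝓐 k x) ^ 2 * w 𝓐 δ k x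

lemma memH_snoc {S : ℕ → Type} {n : ℕ} (A : Hyp S n) (k : ℕ) (x : Qp S k)
    (y : S k) :
    memH A (Fin.snoc x y : Qp S (k + 1)) ↔ memH A x ∧ ∀ h : k ∈ A.F, y = A.val k h := by
  constructor
  · intro H
    refine ⟨fun j h => ?_, fun h => ?_⟩
    · have := H j.castSucc h
      rwa [Fin.snoc_castSucc (α := fun j : Fin (k + 1) => S j)] at this
    · have := H (Fin.last k) h
      rwa [Fin.snoc_last (α := fun j : Fin (k + 1) => S j)] at this
  · rintro ⟨hx, hy⟩ j
    induction j using Fin.lastCases with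
    | last =>
      intro h
      rw [Fin.snoc_last (α := fun j : Fin (k + 1) => S j)]
      exact hy h
    | cast j =>
      intro h
      rw [Fin.snoc_castSucc (α := fun j : Fin (k + 1) => S j)]
      exact hx j h

section Weights

variable {S : ℕ → Type} [∀ j, Fintype (S j)] {n : ℕ} {ι : Type} (𝓐 : ι → Hyp S n) (δ : ℕ → ℝ)

lemma w_snoc (k : ℕ) (x : Qp S k) (y : S k) :
    w 𝓐 δ (k + 1) (Fin.snoc x y : Qp S (k + 1)) =
      if memB 𝓐 (k + 1) (Fin.snoc x y : Qp S (k + 1)) then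
        if alpha 𝓐 k x ≤ δ k then 0
        else ((alpha 𝓐 k x - δ k) / (alpha 𝓐 k x * (1 - δ k))) *
          (w 𝓐 δ k x / (Fintype.card (S k)))
      else
        if alpha 𝓐 k x ≤ δ k then
          (1 / (1 - alpha 𝓐 k x)) * (w 𝓐 δ k x / (Fintype.card (S k)))
        else (1 / (1 - δ k)) * (w 𝓐 δ k x / (Fintype.card (S k))) := by
  have hinit : (fun j : Fin k => (Fin.snoc x y : Qp S (k + 1)) j.castSucc) = x := by
    funext j
    exact Fin.snoc_castSucc (α := fun j : Fin (k + 1) => S j) y x j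
  rw [w]
  simp only [hinit]

variable {δ} in
lemma w_nonneg (k : ℕ) (hδ : ∀ j < k, δ j ∈ Set.Icc (0 : ℝ) (1 / 2)) (x : Qp S k) :
    0 ≤ w 𝓐 δ k x := by
  induction k with
  | zero => simp [w]
  | succ k ih =>
    obtain ⟨h0, h1⟩ := hδ k k.lt_succ_self
    have hw := ih (fun j hj => hδ j (hj.trans k.lt_succ_self)) (fun j => x j.castSucc)
    have hq := div_nonneg hw (Nat.cast_nonneg (α := ℝ) (Fintype.card (S k)))
    rw [w]
    split_ifs with hB ha ha
    · exact le_rfl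
    · push Not at ha
      exact mul_nonneg (div_nonneg (by linarith) (mul_nonneg (by linarith) (by linarith))) hq
    · exact mul_nonneg (one_div_nonneg.2 (by linarith)) hq
    · exact mul_nonneg (one_div_nonneg.2 (by linarith)) hq

variable {δ} in
lemma w_snoc_le (k : ℕ) (hδ : ∀ j < k + 1, δ j ∈ Set.Icc (0 : ℝ) (1 / 2)) (x : Qp S k)
    (y : S k) :
    w 𝓐 δ (k + 1) (Fin.snoc x y : Qp S (k + 1)) ≤
      w 𝓐 δ k x * (1 / ((1 - δ k) * Fintype.card (S k))) := by
  obtain ⟨h0, h1⟩ := hδ k k.lt_succ_self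
  have hw := w_nonneg 𝓐 k (fun j hj => hδ j (hj.trans k.lt_succ_self)) x
  have hq := div_nonneg hw (Nat.cast_nonneg (α := ℝ) (Fintype.card (S k)))
  have hrw : w 𝓐 δ k x * (1 / ((1 - δ k) * Fintype.card (S k))) =
      1 / (1 - δ k) * (w 𝓐 δ k x / Fintype.card (S k)) := by
    rw [one_div, mul_inv]; ring
  have hδ' : (0 : ℝ) < 1 - δ k := by linarith
  rw [w_snoc, hrw]
  split_ifs with hB ha ha
  · exact mul_nonneg (one_div_nonneg.2 hδ'.le) hq
  · push Not at ha
    have hα : 0 < alpha 𝓐 k x := by linarith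
    refine mul_le_mul_of_nonneg_right ?_ hq
    rw [div_le_div_iff₀ (by positivity) hδ']
    nlinarith
  · gcongr
  · exact le_rfl

variable {δ} in
lemma sum_w_snoc (k : ℕ) (hcard : 0 < Fintype.card (S k)) (hδ : δ k ∈ Set.Icc (0 : ℝ) (1 / 2))
    (x : Qp S k) :
    ∑ y : S k, w 𝓐 δ (k + 1) (Fin.snoc x y : Qp S (k + 1)) = w 𝓐 δ k x := by
  obtain ⟨h0, h1⟩ := hδ
  have hc : (0 : ℝ) < Fintype.card (S k) := by exact_mod_cast hcard
  simp only [w_snoc]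
  rw [sum_ite, sum_const, sum_const, nsmul_eq_mul, nsmul_eq_mul]
  have hB : ((univ.filter fun y : S k =>
      memB 𝓐 (k + 1) (Fin.snoc x y : Qp S (k + 1))).card : ℝ) =
      alpha 𝓐 k x * Fintype.card (S k) := by
    rw [alpha, div_mul_cancel₀ _ hc.ne']
  have hadd : ((univ.filter fun y : S k =>
      memB 𝓐 (k + 1) (Fin.snoc x y : Qp S (k + 1))).card : ℝ) +
      ((univ.filter fun y : S k =>
      ¬ memB 𝓐 (k + 1) (Fin.snoc x y : Qp S (k + 1))).card : ℝ) = Fintype.card (S k) := by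
    exact_mod_cast card_filter_add_card_filter_not (s := (univ : Finset (S k))) _
  rw [← eq_sub_iff_add_eq'] at hadd
  rw [hadd, hB]
  split_ifs with ha
  · have : 1 - alpha 𝓐 k x ≠ 0 := by linarith
    field_simp
    ring
  · push Not at ha
    have hα : alpha 𝓐 k x ≠ 0 := by linarith
    have : 1 - δ k ≠ 0 := by linarith
    field_simp
    ring

lemma wH_succ (A : Hyp S n) (k : ℕ) :
    wH 𝓐 δ (k + 1) A = ∑ x ∈ univ.filter (fun x : Qp S k => memH A x),
      ∑ y ∈ univ.filter (fun y : S k => ∀ h : k ∈ A.F, y = A.val k h),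
        w 𝓐 δ (k + 1) (Fin.snoc x y : Qp S (k + 1)) := by
  rw [wH, sum_filter, ← (Fin.snocEquiv fun j : Fin (k + 1) => S j).sum_comp,
    Fintype.sum_prod_type_right, sum_filter]
  refine sum_congr rfl fun x _ => ?_
  change ∑ y : S k, (if memH A (Fin.snoc x y : Qp S (k + 1)) then
    w 𝓐 δ (k + 1) (Fin.snoc x y : Qp S (k + 1)) else 0) = _
  simp only [memH_snoc]
  by_cases hx : memH A x <;> simp [hx, sum_filter]

variable {δ} in
/-- The weight bound for the projection to `Q_k` of an arbitrary hyperplane. -/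
lemma wH_le_nu_filter_lt (A : Hyp S n) (k : ℕ) (hcard : ∀ j < k, 0 < Fintype.card (S j))
    (hδ : ∀ j < k, δ j ∈ Set.Icc (0 : ℝ) (1 / 2)) :
    wH 𝓐 δ k A ≤ nu S δ (A.F.filter (· < k)) := by
  induction k with
  | zero =>
    rw [wH, sum_filter]
    simp [nu, w, memH]
  | succ k ih =>
    have ih := ih (fun j hj => hcard j (hj.trans k.lt_succ_self))
      (fun j hj => hδ j (hj.trans k.lt_succ_self))
    have hδk := hδ k k.lt_succ_self
    rw [wH_succ]
    by_cases hk : k ∈ A.F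
    · have hF : A.F.filter (· < k + 1) = insert k (A.F.filter (· < k)) := by
        ext j
        simp only [mem_filter, mem_insert]
        grind
      have hy : univ.filter (fun y : S k => ∀ h : k ∈ A.F, y = A.val k h) = {A.val k hk} := by
        ext y
        simp [hk]
      rw [hF, nu, prod_insert (by simp), hy, mul_comm]
      simp only [sum_singleton]
      have hpos : 0 ≤ 1 / ((1 - δ k) * (Fintype.card (S k) : ℝ)) :=
        one_div_nonneg.2 (mul_nonneg (by linarith [hδk.2]) (Nat.cast_nonneg _))
      calc _ ≤ ∑ x ∈ univ.filter (fun x : Qp S k => memH A x),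
            w 𝓐 δ k x * (1 / ((1 - δ k) * Fintype.card (S k))) :=
            sum_le_sum fun x _ => w_snoc_le 𝓐 k hδ x _
        _ = wH 𝓐 δ k A * (1 / ((1 - δ k) * Fintype.card (S k))) := by rw [wH, sum_mul]
        _ ≤ _ := mul_le_mul_of_nonneg_right ih hpos
    · have hF : A.F.filter (· < k + 1) = A.F.filter (· < k) := by
        ext j
        simp only [mem_filter]
        grind
      have hy : univ.filter (fun y : S k => ∀ h : k ∈ A.F, y = A.val k h) = univ := by
        ext y
        simp [hk]
      rw [hF, hy]
      simp only [sum_w_snoc 𝓐 k (hcard k k.lt_succ_self) hδk]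
      exact ih

end Weights

/-- For `1 ≤ k ≤ n` (the paper's `k` is `k + 1` here, `k < n`) and every
hyperplane `A` in `Q` (not necessarily belonging to `𝒜`) with
`max F(A) = k` (1-based), one has
`w_k(A) ≤ ν(F(A)) = ∏_{j ∈ F(A)} 1 / ((1 - δ_j)|S_j|)`. -/
theorem weight_hyperplane_le_nu
    (S : ℕ → Type) [∀ j, Fintype (S j)] (n : ℕ) (hn : 0 < n)
    (hcard : ∀ j, j < n → 2 ≤ Fintype.card (S j))
    (δ : ℕ → ℝ) (hδ : ∀ j, j < n → δ j ∈ Set.Icc (0 : ℝ) (1 / 2))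
    (ι : Type) [Fintype ι] (𝓐 : ι → Hyp S n)
    (hFne : ∀ i, (𝓐 i).F.Nonempty)
    (k : ℕ) (hk : k < n)
    (A : Hyp S n) (hAne : A.F.Nonempty) (hstage : A.stage = k + 1) :
    wH 𝓐 δ (k + 1) A ≤ nu S δ A.F := by
  have hF : A.F.filter (· < k + 1) = A.F := by
    refine filter_true_of_mem fun j hj => ?_
    rw [← hstage]
    exact Nat.lt_succ_of_le (le_sup (f := id) hj)
  rw [← hF]
  exact wH_le_nu_filter_lt 𝓐 A (k + 1)
    (fun j hj => by have := hcard j (by omega); omega) (fun j hj => hδ j (by omega))
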